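/- arXiv:1901.10333 — 2 statements merged into one kernel-verified Lean document; each statement's English description precedes it below -/
import Mathlib

section
/- Let T > 0, a, b ∈ (0,1] with a − b ∈ (−1,0). Then for every integer N ≥ 1, every n ∈ {1,...,N}, and every t ∈ [t_n, t_{n+1}), one has ∫₀^{t_n} ((t_n−s)^{a−b} − (t−s)^{a−b}) ds ≤ (T/N)^{1+a−b} · (1 + 2^{a−b} − n^{a−b} − (n+1)^{a−b} + 1/(1+a−b)). -/
theorem intervalIntegrable_sub_rpow {c : ℝ} (hc : -1 < c) (A x y : ℝ) :
    IntervalIntegrable (fun s => (A - s) ^ c) MeasureTheory.volume x y := by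
  have h := (intervalIntegral.intervalIntegrable_rpow' (a := A - x) (b := A - y) hc).comp_sub_left A
  simpa using h

theorem integral_sub_rpow {c : ℝ} (hc : -1 < c) (A B : ℝ) :
    ∫ s in (0:ℝ)..B, (A - s) ^ c = (A ^ (c + 1) - (A - B) ^ (c + 1)) / (c + 1) := by
  rw [intervalIntegral.integral_comp_sub_left (fun x : ℝ => x ^ c) A,
    integral_rpow (Or.inl hc), sub_zero]


/-- The explicit intermediate bound in the proof of Lemma 3.1, case `a - b ∈ (-1,0)`. -/
theorem stmt_2 (T : ℝ) (hT : 0 < T) (a b : ℝ)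
    (ha : a ∈ Set.Ioc (0:ℝ) 1) (hb : b ∈ Set.Ioc (0:ℝ) 1)
    (hab : a - b ∈ Set.Ioo (-1:ℝ) 0) :
    ∀ N : ℕ, 1 ≤ N → ∀ n : ℕ, 1 ≤ n → n ≤ N → ∀ t : ℝ,
      t ∈ Set.Ico ((n : ℝ) * (T / N)) (((n : ℝ) + 1) * (T / N)) →
      (∫ s in (0:ℝ)..((n : ℝ) * (T / N)),
          (((n : ℝ) * (T / N) - s) ^ (a - b) - (t - s) ^ (a - b))) ≤
        (T / N) ^ (1 + a - b) *
          (1 + (2 : ℝ) ^ (a - b) - (n : ℝ) ^ (a - b) - ((n : ℝ) + 1) ^ (a - b)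
            + 1 / (1 + a - b)) := by
  obtain ⟨hc, hc0⟩ := hab
  intro N hN n hn _ t ⟨ht1, ht2⟩
  have hh : 0 < T / N := div_pos hT (by exact_mod_cast hN)
  have hn1 : (1:ℝ) ≤ n := by exact_mod_cast hn
  rw [show 1 + a - b = (a - b) + 1 by ring]
  generalize a - b = c at *
  generalize T / (N:ℝ) = h at *
  have hp : 0 < c + 1 := by linarith
  rw [intervalIntegral.integral_sub (intervalIntegrable_sub_rpow hc _ _ _)
    (intervalIntegrable_sub_rpow hc _ _ _), integral_sub_rpow hc, integral_sub_rpow hc, sub_self,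
    Real.zero_rpow hp.ne', ← sub_div]
  have h1 : ((n:ℝ) * h) ^ (c + 1) ≤ t ^ (c + 1) :=
    Real.rpow_le_rpow (by positivity) ht1 hp.le
  have h2 : (t - n * h) ^ (c + 1) ≤ h ^ (c + 1) :=
    Real.rpow_le_rpow (by linarith) (by linarith) hp.le
  have h3 : (n:ℝ) ^ c ≤ 1 := Real.rpow_le_one_of_one_le_of_nonpos hn1 hc0.le
  have h4 : ((n:ℝ) + 1) ^ c ≤ 2 ^ c :=
    Real.rpow_le_rpow_of_nonpos (by norm_num) (by linarith) hc0.le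
  calc _ ≤ h ^ (c + 1) / (c + 1) := by gcongr; linarith
    _ = h ^ (c + 1) * (1 / (c + 1)) := by ring
    _ ≤ _ := by gcongr; linarith
end

section
/- Let T > 0 and let c ∈ (−1/2, 1/2). Then there exists a constant C > 0, independent of N, such that for every integer N ≥ 1, every n ∈ {0,1,...,N}, and every t ∈ [t_n, t_{n+1}), one has ∫₀^{t_n} |(t−s)^{c} − (t_n−s)^{c}|² ds ≤ C · N^{−1−2c}. -/
open MeasureTheory in
/-- A measurable nonnegative function dominated on `(a, b]` by an interval integrable function is
interval integrable, and its integral is dominated accordingly. -/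
lemma intervalIntegrable_and_integral_le_of_le {f g : ℝ → ℝ} {a b : ℝ} (hab : a ≤ b)
    (hf : Measurable f) (hf0 : ∀ u, 0 ≤ f u) (hg : IntervalIntegrable g volume a b)
    (hfg : ∀ u ∈ Set.Ioc a b, f u ≤ g u) :
    IntervalIntegrable f volume a b ∧ ∫ u in a..b, f u ≤ ∫ u in a..b, g u := by
  have hfi : IntervalIntegrable f volume a b := by
    refine hg.mono_fun hf.aestronglyMeasurable ?_
    rw [Set.uIoc_of_le hab]
    filter_upwards [ae_restrict_mem measurableSet_Ioc] with u hu
    rw [Real.norm_of_nonneg (hf0 u)]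
    exact (hfg u hu).trans (le_abs_self _)
  exact ⟨hfi, intervalIntegral.integral_mono_on_of_le_Ioo hab hfi hg
    fun u hu => hfg u ⟨hu.1, hu.2.le⟩⟩

lemma abs_one_add_rpow_sub_one_le {x c : ℝ} (hx : 0 ≤ x) (hc : |c| ≤ 1) :
    |(1 + x) ^ c - 1| ≤ x := by
  obtain ⟨hc1, hc2⟩ := abs_le.mp hc
  have h1 : (1 + x) ^ c ≤ (1 + x) ^ (1 : ℝ) :=
    Real.rpow_le_rpow_of_exponent_le (by linarith) hc2
  have h2 : (1 + x) ^ (-1 : ℝ) ≤ (1 + x) ^ c :=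
    Real.rpow_le_rpow_of_exponent_le (by linarith) hc1
  rw [Real.rpow_one] at h1
  rw [Real.rpow_neg_one] at h2
  have h3 : 1 - x ≤ (1 + x)⁻¹ := by
    rw [← one_div, le_div_iff₀ (by linarith)]
    nlinarith
  rw [abs_le]
  constructor <;> linarith

lemma sq_add_rpow_sub_rpow_le {u d c : ℝ} (hu : 0 < u) (hd : 0 ≤ d) (hc : |c| ≤ 1) :
    |(u + d) ^ c - u ^ c| ^ 2 ≤ d ^ 2 * u ^ (2 * c - 2) := by
  have h1 := abs_one_add_rpow_sub_one_le (div_nonneg hd hu.le) hc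
  have h2 : (u + d) ^ c - u ^ c = u ^ c * ((1 + d / u) ^ c - 1) := by
    rw [mul_sub, ← Real.mul_rpow hu.le (by positivity), mul_one]
    congr 2
    field_simp
  have h3 : u ^ (2 * c - 2) = (u ^ c) ^ 2 / u ^ 2 := by
    rw [Real.rpow_sub hu, mul_comm 2 c, Real.rpow_mul hu.le]
    norm_cast
  calc |(u + d) ^ c - u ^ c| ^ 2 = (u ^ c) ^ 2 * |(1 + d / u) ^ c - 1| ^ 2 := by
        rw [h2, abs_mul, mul_pow, sq_abs (u ^ c)]
    _ ≤ (u ^ c) ^ 2 * (d / u) ^ 2 := by gcongr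
    _ = d ^ 2 * u ^ (2 * c - 2) := by rw [h3]; ring

lemma sq_add_rpow_sub_rpow_le_of_le {u d h c : ℝ} (hu : 0 < u) (hd : 0 ≤ d) (hdh : d ≤ h)
    (huh : u ≤ h) (hc : 2 * c ≤ 1) :
    |(u + d) ^ c - u ^ c| ^ 2 ≤ 2 * u ^ (2 * c) + 2 * h ^ (2 * c) := by
  have hh : 0 < h := hu.trans_le huh
  have hsq : ∀ x : ℝ, 0 < x → (x ^ c) ^ 2 = x ^ (2 * c) := fun x hx => by
    rw [mul_comm 2 c, Real.rpow_mul hx.le]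
    norm_cast
  have h1 : |(u + d) ^ c - u ^ c| ^ 2 ≤ (u + d) ^ (2 * c) + u ^ (2 * c) := by
    rw [← hsq u hu, ← hsq (u + d) (by linarith), sq_abs]
    have := mul_nonneg (Real.rpow_nonneg (by linarith : 0 ≤ u + d) c) (Real.rpow_nonneg hu.le c)
    nlinarith
  have hu0 : 0 ≤ u ^ (2 * c) := Real.rpow_nonneg hu.le _
  have hh0 : 0 ≤ h ^ (2 * c) := Real.rpow_nonneg hh.le _
  rcases le_total 0 c with h0 | h0
  · have h2 : (u + d) ^ (2 * c) ≤ (2 * h) ^ (2 * c) :=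
      Real.rpow_le_rpow (by linarith) (by linarith) (by linarith)
    rw [Real.mul_rpow (by norm_num) hh.le] at h2
    have h3 : (2 : ℝ) ^ (2 * c) ≤ 2 ^ (1 : ℝ) :=
      Real.rpow_le_rpow_of_exponent_le (by norm_num) hc
    rw [Real.rpow_one] at h3
    nlinarith
  · have h2 : (u + d) ^ (2 * c) ≤ u ^ (2 * c) :=
      Real.rpow_le_rpow_of_nonpos hu (by linarith) (by linarith)
    linarith

lemma integral_sq_add_rpow_sub_rpow_le {A d h c : ℝ} (hh : 0 < h) (hd : 0 ≤ d) (hdh : d ≤ h)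
    (hA : h ≤ A) (hc : c ∈ Set.Ioo (-(1/2) : ℝ) (1/2)) :
    ∫ u in (0 : ℝ)..A, |(u + d) ^ c - u ^ c| ^ 2 ≤
      (2 / (1 + 2 * c) + 2 + 1 / (1 - 2 * c)) * h ^ (1 + 2 * c) := by
  obtain ⟨hc1, hc2⟩ := hc
  have hm : Measurable fun u : ℝ => |(u + d) ^ c - u ^ c| ^ 2 := by fun_prop
  have hnn : ∀ u : ℝ, 0 ≤ |(u + d) ^ c - u ^ c| ^ 2 := fun u => by positivity
  have hi : IntervalIntegrable (fun u : ℝ => u ^ (2 * c)) MeasureTheory.volume 0 h :=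
    intervalIntegral.intervalIntegrable_rpow' (by linarith)
  have hnot : (0 : ℝ) ∉ Set.uIcc h A := by
    rw [Set.uIcc_of_le hA]
    exact fun h0 => absurd h0.1 (by linarith)
  obtain ⟨i1, l1⟩ := intervalIntegrable_and_integral_le_of_le hh.le hm hnn
    ((hi.const_mul 2).add (intervalIntegrable_const (c := 2 * h ^ (2 * c))))
    fun u hu => sq_add_rpow_sub_rpow_le_of_le hu.1 hd hdh hu.2 (by linarith)
  obtain ⟨i2, l2⟩ := intervalIntegrable_and_integral_le_of_le hA hm hnn
    ((intervalIntegral.intervalIntegrable_rpow (r := 2 * c - 2) (Or.inr hnot)).const_mul (d ^ 2))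
    fun u hu => sq_add_rpow_sub_rpow_le (hh.trans hu.1) hd (by rw [abs_le]; constructor <;> linarith)
  rw [intervalIntegral.integral_add (hi.const_mul 2) intervalIntegrable_const,
    intervalIntegral.integral_const_mul, intervalIntegral.integral_const,
    integral_rpow (Or.inl (by linarith)), Real.zero_rpow (by linarith), smul_eq_mul] at l1
  rw [intervalIntegral.integral_const_mul,
    integral_rpow (Or.inr ⟨by linarith, hnot⟩)] at l2
  have e1 : h * h ^ (2 * c) = h ^ (1 + 2 * c) := by
    rw [Real.rpow_add hh, Real.rpow_one]
  have e2 : h ^ 2 * h ^ (2 * c - 2 + 1) = h ^ (1 + 2 * c) := by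
    rw [← Real.rpow_natCast h 2, ← Real.rpow_add hh]
    congr 1
    push_cast
    ring
  have hp : 0 < 1 - 2 * c := by linarith
  have l3 : d ^ 2 * ((A ^ (2 * c - 2 + 1) - h ^ (2 * c - 2 + 1)) / (2 * c - 2 + 1)) ≤
      h ^ (1 + 2 * c) / (1 - 2 * c) := by
    have hA0 : 0 ≤ A ^ (2 * c - 2 + 1) := Real.rpow_nonneg (by linarith) _
    calc d ^ 2 * ((A ^ (2 * c - 2 + 1) - h ^ (2 * c - 2 + 1)) / (2 * c - 2 + 1))
        = d ^ 2 * ((h ^ (2 * c - 2 + 1) - A ^ (2 * c - 2 + 1)) / (1 - 2 * c)) := by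
          rw [← neg_div_neg_eq]
          ring_nf
      _ ≤ d ^ 2 * (h ^ (2 * c - 2 + 1) / (1 - 2 * c)) := by gcongr; linarith
      _ ≤ h ^ 2 * (h ^ (2 * c - 2 + 1) / (1 - 2 * c)) := by gcongr
      _ = h ^ (1 + 2 * c) / (1 - 2 * c) := by rw [← e2]; ring
  rw [← intervalIntegral.integral_add_adjacent_intervals i1 i2]
  calc _ ≤ _ := add_le_add l1 (l2.trans l3)
    _ = 2 / (1 + 2 * c) * h ^ (1 + 2 * c) + 2 * (h * h ^ (2 * c)) +
        h ^ (1 + 2 * c) / (1 - 2 * c) := by rw [add_comm (2 * c) 1]; ring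
    _ = _ := by rw [e1]; ring


/-- The case `a - b ∈ (-1/2, 1/2)` of Lemma 3.2 of the paper, with exponent `c = a - b`. -/
theorem stmt_7 (T : ℝ) (hT : 0 < T) (c : ℝ) (hc : c ∈ Set.Ioo (-(1/2) : ℝ) (1/2)) :
    ∃ C : ℝ, 0 < C ∧ ∀ N : ℕ, 1 ≤ N → ∀ n : ℕ, n ≤ N → ∀ t : ℝ,
      t ∈ Set.Ico ((n : ℝ) * (T / N)) (((n : ℝ) + 1) * (T / N)) →
      (∫ s in (0:ℝ)..((n : ℝ) * (T / N)),
          |(t - s) ^ c - ((n : ℝ) * (T / N) - s) ^ c| ^ 2) ≤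
        C * (N : ℝ) ^ (-1 - 2 * c) := by
  have hc1 : 0 < 1 + 2 * c := by linarith [hc.1]
  have hc2 : 0 < 1 - 2 * c := by linarith [hc.2]
  refine ⟨(2 / (1 + 2 * c) + 2 + 1 / (1 - 2 * c)) * T ^ (1 + 2 * c), by positivity, ?_⟩
  intro N hN n _ t ht
  have hN0 : (0 : ℝ) < N := by exact_mod_cast hN
  rcases Nat.eq_zero_or_pos n with rfl | hn
  · simp only [Nat.cast_zero, zero_mul, intervalIntegral.integral_same]
    positivity
  set h := T / N with hh
  have hpos : 0 < h := by positivity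
  set A := (n : ℝ) * h with hAdef
  have hA : h ≤ A := le_mul_of_one_le_left hpos.le (by exact_mod_cast hn)
  have hlt : t < A + h := by linarith [ht.2, add_mul (n : ℝ) 1 h]
  have key := integral_sq_add_rpow_sub_rpow_le (d := t - A) hpos (by linarith [ht.1])
    (by linarith) hA hc
  have hsub := intervalIntegral.integral_comp_sub_left (a := 0) (b := A)
    (fun u : ℝ => |(u + (t - A)) ^ c - u ^ c| ^ 2) A
  rw [sub_self, sub_zero] at hsub
  have hscale : h ^ (1 + 2 * c) = T ^ (1 + 2 * c) * (N : ℝ) ^ (-1 - 2 * c) := by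
    rw [hh, Real.div_rpow hT.le hN0.le, div_eq_mul_inv, ← Real.rpow_neg hN0.le]
    ring_nf
  rw [mul_assoc, ← hscale]
  refine le_of_eq_of_le ?_ key
  rw [← hsub]
  congr 1
  ext s
  ring_nf
end
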